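/- arXiv:2003.12379 — 3 statements merged into one kernel-verified Lean document; each statement's English description precedes it below -/
import Mathlib

section
/- Let G be a graph with 2h vertices, none of which is isolated, whose vertices are labeled so that condition (*) holds: V(G) is the disjoint union of X = {x_1,…,x_h} and Y = {y_1,…,y_h}, where X is a minimal vertex cover of G, Y is a maximal independent set of G, and x_i y_i ∈ E(G) for every 1 ≤ i ≤ h. Then G is very well-covered if and only if the following two conditions hold: (i) for distinct indices i, j, k and for z_i ∈ {x_i, y_i}, if z_i x_j ∈ E(G) and y_j x_k ∈ E(G), then z_i x_k ∈ E(G); (ii) if x_i y_j ∈ E(G), then x_i x_j ∉ E(G). -/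
/-- An independent set in a graph. -/
def IsIndepSet {V : Type*} (G : SimpleGraph V) (A : Set V) : Prop :=
  A.Pairwise fun u v => ¬ G.Adj u v

/-- A maximal independent set in a graph. -/
def IsMaxIndepSet {V : Type*} (G : SimpleGraph V) (A : Set V) : Prop :=
  IsIndepSet G A ∧ ∀ B, IsIndepSet G B → A ⊆ B → A = B

/-- A vertex cover of a graph. -/
def IsVertexCover {V : Type*} (G : SimpleGraph V) (C : Set V) : Prop :=
  ∀ ⦃u v⦄, G.Adj u v → u ∈ C ∨ v ∈ C

/-- A minimal vertex cover of a graph. -/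
def IsMinVertexCover {V : Type*} (G : SimpleGraph V) (C : Set V) : Prop :=
  IsVertexCover G C ∧ ∀ B ⊆ C, IsVertexCover G B → B = C

/-- A graph has no isolated vertices. -/
def HasNoIsolatedVertices {V : Type*} (G : SimpleGraph V) : Prop :=
  ∀ v, ∃ u, G.Adj v u

/-- A graph is very well-covered if it has no isolated vertices, an even number of
vertices, and every maximal independent set has cardinality half the number of vertices. -/
def IsVeryWellCovered {V : Type*} [Fintype V] (G : SimpleGraph V) : Prop :=
  HasNoIsolatedVertices G ∧ Even (Fintype.card V) ∧
    ∀ A : Set V, IsMaxIndepSet G A → A.ncard = Fintype.card V / 2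

/-- Condition (*) for a graph on the `2h` vertices `x_1, …, x_h, y_1, …, y_h`
(encoded as `Sum.inl 0, …, Sum.inl (h-1), Sum.inr 0, …, Sum.inr (h-1)`):
`X = {x_1, …, x_h}` is a minimal vertex cover, `Y = {y_1, …, y_h}` is a maximal
independent set, and `x_i y_i` is an edge for every `i`. -/
def CondStar {h : ℕ} (G : SimpleGraph (Fin h ⊕ Fin h)) : Prop :=
  IsMinVertexCover G (Set.range Sum.inl) ∧
    IsMaxIndepSet G (Set.range Sum.inr) ∧
    ∀ i : Fin h, G.Adj (Sum.inl i) (Sum.inr i)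

theorem IsIndepSet.exists_isMaxIndepSet_superset {V : Type*} [Finite V] {G : SimpleGraph V}
    {B : Set V} (hB : IsIndepSet G B) : ∃ A, B ⊆ A ∧ IsMaxIndepSet G A := by
  obtain ⟨A, hBA, hA⟩ := (Set.toFinite {A : Set V | IsIndepSet G A}).exists_le_maximal hB
  exact ⟨A, hBA, hA.prop, fun C hC hAC => hA.eq_of_le hC hAC⟩

theorem IsIndepSet.not_adj {V : Type*} {G : SimpleGraph V} {A : Set V} (hA : IsIndepSet G A)
    {u v : V} (hu : u ∈ A) (hv : v ∈ A) : ¬ G.Adj u v :=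
  fun huv => hA hu hv huv.ne huv

theorem IsMaxIndepSet.exists_adj_of_notMem {V : Type*} {G : SimpleGraph V} {A : Set V}
    (hA : IsMaxIndepSet G A) {v : V} (hv : v ∉ A) : ∃ u ∈ A, G.Adj u v := by
  by_contra! hcon
  have hins : IsIndepSet G (insert v A) :=
    Set.Pairwise.insert hA.1 fun u hu _ => ⟨fun huv => hcon u hu huv.symm, hcon u hu⟩
  rw [hA.2 _ hins (Set.subset_insert v A)] at hv
  exact hv (Set.mem_insert v A)

/-- In a graph with a perfect matching `x_i y_i`, an independent set has half of the vertices
exactly when it meets every edge of the matching. -/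
theorem IsIndepSet.ncard_eq_iff {h : ℕ} {G : SimpleGraph (Fin h ⊕ Fin h)}
    (hG : ∀ i, G.Adj (Sum.inl i) (Sum.inr i)) {A : Set (Fin h ⊕ Fin h)} (hA : IsIndepSet G A) :
    A.ncard = h ↔ ∀ j, Sum.inl j ∈ A ∨ Sum.inr j ∈ A := by
  have hinj : Set.InjOn (Sum.elim id id : Fin h ⊕ Fin h → Fin h) A := by
    rintro (a | a) ha (b | b) hb hab <;> obtain rfl : a = b := hab
    · rfl
    · exact (hA.not_adj ha hb (hG a)).elim
    · exact (hA.not_adj hb ha (hG a)).elim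
    · rfl
  have huniv : Sum.elim id id '' A = (Set.univ : Set (Fin h)) ↔
      ∀ j, Sum.inl j ∈ A ∨ Sum.inr j ∈ A := by
    simp [Set.eq_univ_iff_forall]
  rw [← huniv, ← hinj.ncard_image]
  constructor
  · intro hcard
    exact Set.eq_of_subset_of_ncard_le (Set.subset_univ _) (by simp [Set.ncard_univ, hcard])
  · intro himage
    simp [himage, Set.ncard_univ]

/-- In a very well-covered graph with a perfect matching `x_i y_i`, no independent set has
neighbours of both ends of an edge of the matching. -/
theorem IsVeryWellCovered.not_adj_of_adj {h : ℕ} {G : SimpleGraph (Fin h ⊕ Fin h)}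
    (hW : IsVeryWellCovered G) (hG : ∀ i, G.Adj (Sum.inl i) (Sum.inr i))
    {B : Set (Fin h ⊕ Fin h)} (hB : IsIndepSet G B) {u v : Fin h ⊕ Fin h} (hu : u ∈ B)
    (hv : v ∈ B) {j : Fin h} (huj : G.Adj u (Sum.inl j)) : ¬ G.Adj v (Sum.inr j) := by
  intro hvj
  obtain ⟨A, hBA, hA⟩ := hB.exists_isMaxIndepSet_superset
  have hcard : A.ncard = h := by
    rw [hW.2.2 A hA, Fintype.card_sum, Fintype.card_fin]
    omega
  rcases (hA.1.ncard_eq_iff hG).1 hcard j with hj | hj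
  · exact hA.1.not_adj (hBA hu) hj huj
  · exact hA.1.not_adj (hBA hv) hj hvj

/-- A graph `G` with `2h` non-isolated vertices labeled so that condition (*) holds is very
well-covered if and only if: (i) for distinct `i, j, k` and `z_i ∈ {x_i, y_i}`, if `z_i x_j`
and `y_j x_k` are edges then so is `z_i x_k`; and (ii) if `x_i y_j` is an edge then
`x_i x_j` is not. -/
theorem veryWellCovered_iff {h : ℕ} (G : SimpleGraph (Fin h ⊕ Fin h))
    (hiso : HasNoIsolatedVertices G) (hstar : CondStar G) :
    IsVeryWellCovered G ↔
      ((∀ i j k : Fin h, i ≠ j → j ≠ k → i ≠ k → ∀ z : Fin h ⊕ Fin h,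
          (z = Sum.inl i ∨ z = Sum.inr i) →
          G.Adj z (Sum.inl j) → G.Adj (Sum.inr j) (Sum.inl k) → G.Adj z (Sum.inl k)) ∧
        (∀ i j : Fin h, G.Adj (Sum.inl i) (Sum.inr j) →
          ¬ G.Adj (Sum.inl i) (Sum.inl j))) := by
  obtain ⟨-, hY, hG⟩ := hstar
  constructor
  · refine fun hW => ⟨?_, fun i j hy hx => ?_⟩
    · intro i j k _ _ hik z hz hzj hjk
      by_contra hzk
      have hB : IsIndepSet G {z, Sum.inl k} :=
        Set.pairwise_pair.2 fun _ => ⟨hzk, fun hkz => hzk hkz.symm⟩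
      exact hW.not_adj_of_adj hG hB (by simp) (by simp) hzj hjk.symm
    · exact hW.not_adj_of_adj hG (Set.pairwise_singleton (Sum.inl i) _) rfl rfl hx hy
  · rintro ⟨htrans, hnot⟩
    refine ⟨hiso, by simp, fun A hA => ?_⟩
    have hcard : A.ncard = h := by
      refine (hA.1.ncard_eq_iff hG).2 fun j => ?_
      by_contra! hj
      obtain ⟨z, hzA, hzj⟩ := hA.exists_adj_of_notMem hj.1
      obtain ⟨w, hwA, hwj⟩ := hA.exists_adj_of_notMem hj.2
      obtain k | k := w
      · have hkj : j ≠ k := by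
          rintro rfl
          exact hj.1 hwA
        obtain ⟨i, hzi⟩ : ∃ i, z = Sum.inl i ∨ z = Sum.inr i := by
          cases z <;> simp
        have hij : i ≠ j := by
          rintro rfl
          rcases hzi with rfl | rfl
          exacts [hj.1 hzA, hj.2 hzA]
        by_cases hik : i = k
        · subst hik
          rcases hzi with rfl | rfl
          exacts [hnot i j hwj hzj, hA.1.not_adj hwA hzA (hG i)]
        · exact hA.1.not_adj hzA hwA (htrans i j k hij hkj hik z hzi hzj hwj.symm)
      · exact hY.1.not_adj ⟨k, rfl⟩ ⟨j, rfl⟩ hwj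
    rw [hcard, Fintype.card_sum, Fintype.card_fin]
    omega
end

section
/- Let G be a very well-covered graph with 2h vertices, labeled so that condition (*) holds: V(G) is the disjoint union of the minimal vertex cover X = {x_1,…,x_h} and the maximal independent set Y = {y_1,…,y_h} with x_i y_i ∈ E(G) for all i, and let w : E(G) → Z_{>0} be an edge weight such that the edge-weighted edge ideal I(G_w) is unmixed. If x_i y_j ∈ E(G) and x_j y_i ∈ E(G) for some indices i ≠ j, then w(x_i y_i) = w(x_j y_j) = w(x_i y_j) = w(x_j y_i). -/
/-- The height of an ideal `p` (intended: a prime ideal), i.e. the Krull dimension of the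
set of prime ideals contained in `p`. -/
noncomputable def idealHeight {R : Type*} [CommRing R] (p : Ideal R) : WithBot ℕ∞ :=
  Order.krullDim {q : PrimeSpectrum R // q.asIdeal ≤ p}

/-- An ideal `I ⊆ R` is unmixed if all associated primes of `R ⧸ I` have the same height. -/
def IsUnmixedIdeal {R : Type*} [CommRing R] (I : Ideal R) : Prop :=
  ∀ p ∈ associatedPrimes R (R ⧸ I), ∀ q ∈ associatedPrimes R (R ⧸ I),
    idealHeight p = idealHeight q

/-- The monomial associated to a weighted edge: `(X u * X v) ^ w(e)` for `e = uv`. -/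
noncomputable def edgeMonomial {V : Type*} (K : Type*) [CommSemiring K]
    (w : Sym2 V → ℕ) (e : Sym2 V) : MvPolynomial V K :=
  (Sym2.lift ⟨fun u v => MvPolynomial.X u * MvPolynomial.X v,
    fun u v => mul_comm _ _⟩ e) ^ w e

/-- The edge-weighted edge ideal `I(G_w)` of an edge-weighted graph `G_w`. -/
noncomputable def weightedEdgeIdeal {V : Type*} (K : Type*) [CommSemiring K]
    (G : SimpleGraph V) (w : Sym2 V → ℕ) : Ideal (MvPolynomial V K) :=
  Ideal.span (edgeMonomial K w '' G.edgeSet)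

/-- For prime ideals, `idealHeight` is Mathlib's height. -/
theorem idealHeight_eq_height {R : Type*} [CommRing R] (p : Ideal R) [hp : p.IsPrime] :
    idealHeight p = (p.height : WithBot ℕ∞) := by
  have h := Order.height_eq_krullDim_Iic (⟨p, hp⟩ : PrimeSpectrum R)
  rw [← PrimeSpectrum.height_eq_orderHeight] at h
  exact h.symm

/-- If some `f ∉ I` has all primes over the annihilator of `f` modulo `I` strictly larger than a
given minimal prime of `I`, then `I` is not unmixed. -/
theorem not_isUnmixedIdeal_of_colon {R : Type*} [CommRing R] [IsNoetherianRing R] {I P₀ : Ideal R}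
    (hP₀ : P₀ ∈ I.minimalPrimes) {f : R} (hf : f ∉ I)
    (hlt : ∀ P : Ideal R, P.IsPrime → (∀ r, r * f ∈ I → r ∈ P) → P₀ < P) :
    ¬ IsUnmixedIdeal I := by
  intro hunm
  have hP₀ass : P₀ ∈ associatedPrimes R (R ⧸ I) := by
    apply Module.associatedPrimes.minimalPrimes_annihilator_subset_associatedPrimes
    rwa [Ideal.annihilator_quotient]
  obtain ⟨P, hP, hle⟩ := exists_le_isAssociatedPrime_of_isNoetherianRing R
    (Ideal.Quotient.mk I f) (by rwa [Ne, Ideal.Quotient.eq_zero_iff_mem])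
  have hPp : P.IsPrime := hP.isPrime
  have hP₀p : P₀.IsPrime := hP₀ass.isPrime
  have hlt' : P₀ < P := hlt P hPp fun r hr ↦ hle <| by
    rw [Submodule.mem_colon_singleton, Submodule.mem_bot]
    exact Ideal.Quotient.eq_zero_iff_mem.2 hr
  have h := hunm P₀ hP₀ass P hP
  rw [idealHeight_eq_height, idealHeight_eq_height, WithBot.coe_inj] at h
  exact (Ideal.height_strict_mono_of_isPrime_of_isPrime hlt').ne h

section ZeroVars

variable {V K : Type*} [Field K]

open Classical in
/-- The substitution setting to zero the variables in `C`. -/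
noncomputable def zeroVars (K : Type*) [Field K] (C : Set V) :
    MvPolynomial V K →ₐ[K] MvPolynomial V K :=
  MvPolynomial.aeval fun v ↦ if v ∈ C then 0 else MvPolynomial.X v

theorem X_mem_ker_zeroVars {C : Set V} {v : V} :
    (MvPolynomial.X v : MvPolynomial V K) ∈ RingHom.ker (zeroVars K C) ↔ v ∈ C := by
  simp [RingHom.mem_ker, zeroVars]

theorem ker_zeroVars_le {C : Set V} {P : Ideal (MvPolynomial V K)}
    (h : ∀ c ∈ C, MvPolynomial.X c ∈ P) : RingHom.ker (zeroVars K C) ≤ P := by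
  have key : (Ideal.Quotient.mkₐ K P).comp (zeroVars K C) = Ideal.Quotient.mkₐ K P := by
    ext v
    by_cases hv : v ∈ C
    · simpa [zeroVars, hv] using (Ideal.Quotient.eq_zero_iff_mem.2 (h v hv)).symm
    · simp [zeroVars, hv]
  intro f hf
  rw [RingHom.mem_ker] at hf
  have := DFunLike.congr_fun key f
  rw [AlgHom.comp_apply, hf, map_zero] at this
  exact Ideal.Quotient.eq_zero_iff_mem.1 this.symm

end ZeroVars

section WeightedEdgeIdeal

variable {V K : Type*} [Field K] {G : SimpleGraph V} {w : Sym2 V → ℕ}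

theorem edge_mem_weightedEdgeIdeal {u v : V} (h : G.Adj u v) :
    (MvPolynomial.X u * MvPolynomial.X v : MvPolynomial V K) ^ w s(u, v) ∈
      weightedEdgeIdeal K G w :=
  Ideal.subset_span ⟨s(u, v), h, rfl⟩

theorem weightedEdgeIdeal_le_iff {J : Ideal (MvPolynomial V K)} :
    weightedEdgeIdeal K G w ≤ J ↔ ∀ u v, G.Adj u v →
      (MvPolynomial.X u * MvPolynomial.X v : MvPolynomial V K) ^ w s(u, v) ∈ J := by
  refine ⟨fun h u v huv ↦ h (edge_mem_weightedEdgeIdeal huv), fun h ↦ Ideal.span_le.2 ?_⟩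
  rintro _ ⟨e, he, rfl⟩
  induction e using Sym2.ind with
  | _ u v => exact h u v he

/-- The complement of a maximal independent set generates a minimal prime of the edge ideal. -/
theorem ker_zeroVars_compl_mem_minimalPrimes (hw : ∀ e ∈ G.edgeSet, 0 < w e) {A : Set V}
    (hA : IsIndepSet G A) (hnb : ∀ c ∉ A, ∃ b ∈ A, G.Adj c b) :
    RingHom.ker (zeroVars K Aᶜ) ∈ (weightedEdgeIdeal K G w).minimalPrimes := by
  refine ⟨⟨RingHom.ker_isPrime _, weightedEdgeIdeal_le_iff.2 fun u v huv ↦ ?_⟩, ?_⟩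
  · refine Ideal.pow_mem_of_mem _ ?_ _ (hw _ huv)
    by_cases hu : u ∈ A
    · exact Ideal.mul_mem_left _ _
        (X_mem_ker_zeroVars.2 fun hv ↦ hA hu hv huv.ne huv)
    · exact Ideal.mul_mem_right _ _ (X_mem_ker_zeroVars.2 hu)
  · rintro P ⟨hP, hIP⟩ hle
    refine ker_zeroVars_le fun c hc ↦ ?_
    obtain ⟨b, hb, hcb⟩ := hnb c hc
    have := hP.mem_of_pow_mem _ (weightedEdgeIdeal_le_iff.1 hIP c b hcb)
    exact (hP.mem_or_mem this).resolve_right fun hbP ↦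
      (X_mem_ker_zeroVars.1 (hle hbP)) hb

/-- Let `A` be an independent set and `B ⊆ A` a subset meeting the neighbourhood of every vertex
outside `A`. If a vertex `p ∉ A` is joined to some `q ∈ A` by an edge lighter than all edges from
`p` to `B`, then the edge-weighted edge ideal is not unmixed. -/
theorem not_isUnmixedIdeal_of_lighter_edge [Finite V] (hw : ∀ e ∈ G.edgeSet, 0 < w e) {A B : Set V}
    (hA : IsIndepSet G A) (hBA : B ⊆ A) (hnb : ∀ c ∉ A, ∃ b ∈ B, G.Adj c b)
    {p q : V} (hp : p ∉ A) (hq : q ∈ A) (hpq : G.Adj p q)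
    (hlt : ∀ b ∈ B, G.Adj p b → w s(p, q) < w s(p, b)) :
    ¬ IsUnmixedIdeal (weightedEdgeIdeal K G w) := by
  classical
  have := Fintype.ofFinite V
  let N : ℕ := ∑ e, w e
  let g : MvPolynomial V K := ∏ b ∈ B.toFinset, MvPolynomial.X b ^ N
  refine not_isUnmixedIdeal_of_colon
    (ker_zeroVars_compl_mem_minimalPrimes hw hA fun c hc ↦
      (hnb c hc).imp fun b hb ↦ ⟨hBA hb.1, hb.2⟩)
    (f := MvPolynomial.X p ^ w s(p, q) * g) ?_ ?_
  · let φ : MvPolynomial V K →ₐ[K] Polynomial K := MvPolynomial.aeval fun v ↦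
      if v = p then Polynomial.X else if v ∈ B then 1 else 0
    have hφp : φ (MvPolynomial.X p) = Polynomial.X := by simp [φ]
    have hφB : ∀ b ∈ B, φ (MvPolynomial.X b) = 1 := fun b hb ↦ by
      have : b ≠ p := fun h ↦ hp (h ▸ hBA hb)
      simp [φ, this, hb]
    have hφ0 : ∀ v, v ≠ p → v ∉ B → φ (MvPolynomial.X v) = 0 := fun v h₁ h₂ ↦ by
      simp [φ, h₁, h₂]
    have hI : weightedEdgeIdeal K G w ≤
        (Ideal.span {(Polynomial.X : Polynomial K) ^ (w s(p, q) + 1)}).comap φ := by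
      refine weightedEdgeIdeal_le_iff.2 fun u v huv ↦ ?_
      have hpb : ∀ b ∈ B, G.Adj p b → φ ((MvPolynomial.X p * MvPolynomial.X b) ^ w s(p, b)) ∈
          Ideal.span {(Polynomial.X : Polynomial K) ^ (w s(p, q) + 1)} := fun b hb hadj ↦ by
        rw [map_pow, map_mul, hφp, hφB b hb, mul_one, Ideal.mem_span_singleton]
        exact pow_dvd_pow _ (hlt b hb hadj)
      rw [Ideal.mem_comap]
      have hw0 := (hw s(u, v) huv).ne'
      by_cases hu0 : u ≠ p ∧ u ∉ B
      · rw [map_pow, map_mul, hφ0 u hu0.1 hu0.2, zero_mul, zero_pow hw0]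
        exact Ideal.zero_mem _
      by_cases hv0 : v ≠ p ∧ v ∉ B
      · rw [map_pow, map_mul, hφ0 v hv0.1 hv0.2, mul_zero, zero_pow hw0]
        exact Ideal.zero_mem _
      by_cases hup : u = p
      · subst hup
        have hvu : v ≠ u := huv.ne'
        exact hpb v (by tauto) huv
      by_cases hvp : v = p
      · subst hvp
        rw [mul_comm, Sym2.eq_swap (a := u)]
        exact hpb u (by tauto) huv.symm
      · exact absurd huv (hA (hBA (by tauto)) (hBA (by tauto)) huv.ne)
    intro hmem
    have h := hI hmem
    have hg : φ g = 1 := by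
      rw [map_prod]
      refine Finset.prod_eq_one fun b hb ↦ ?_
      rw [map_pow, hφB b (Set.mem_toFinset.1 hb), one_pow]
    rw [Ideal.mem_comap, map_mul, hg, mul_one, map_pow, hφp, Ideal.mem_span_singleton,
      Polynomial.X_pow_dvd_iff] at h
    simpa using h _ (Nat.lt_succ_self _)
  · intro P hP hcolon
    have hle : RingHom.ker (zeroVars K Aᶜ) ≤ P := ker_zeroVars_le fun c hc ↦ by
      obtain ⟨b, hb, hcb⟩ := hnb c hc
      refine hP.mem_of_pow_mem (w s(c, b)) (hcolon _ ?_)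
      have hdvd : (MvPolynomial.X b : MvPolynomial V K) ^ w s(c, b) ∣
          MvPolynomial.X p ^ w s(p, q) * g :=
        ((pow_dvd_pow _ (Finset.single_le_sum (f := w) (fun _ _ ↦ Nat.zero_le _)
          (Finset.mem_univ _))).trans
          (Finset.dvd_prod_of_mem (fun b ↦ (MvPolynomial.X b : MvPolynomial V K) ^ N)
            (Set.mem_toFinset.2 hb))).mul_left _
      refine Ideal.mem_of_dvd _ (mul_dvd_mul_left _ hdvd) ?_
      rw [← mul_pow]
      exact edge_mem_weightedEdgeIdeal hcb
    refine lt_of_le_of_ne hle fun heq ↦ ?_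
    have hqP : MvPolynomial.X q ∈ P := by
      refine hP.mem_of_pow_mem (w s(p, q)) (hcolon _ ?_)
      rw [← mul_assoc, ← mul_pow, mul_comm (MvPolynomial.X q)]
      exact Ideal.mul_mem_right _ _ (edge_mem_weightedEdgeIdeal hpq)
    rw [← heq, X_mem_ker_zeroVars] at hqP
    exact hqP hq

end WeightedEdgeIdeal

theorem IsIndepSet.exists_isMaxIndepSet {V : Type*} [Finite V] {G : SimpleGraph V} {T : Set V}
    (hT : IsIndepSet G T) : ∃ A, IsMaxIndepSet G A ∧ T ⊆ A := by
  obtain ⟨A, hTA, hA⟩ := Finite.exists_le_maximal hT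
  exact ⟨A, ⟨hA.1, fun B hB hAB ↦ hA.eq_of_le hB hAB⟩, hTA⟩

section VeryWellCovered

variable {h : ℕ} {G : SimpleGraph (Fin h ⊕ Fin h)}

theorem IsMaxIndepSet.mem_or_swap_mem (hvwc : IsVeryWellCovered G)
    (hmatch : ∀ i : Fin h, G.Adj (Sum.inl i) (Sum.inr i)) {A : Set (Fin h ⊕ Fin h)}
    (hA : IsMaxIndepSet G A) (v : Fin h ⊕ Fin h) : v ∈ A ∨ v.swap ∈ A := by
  let π : Fin h ⊕ Fin h → Fin h := Sum.elim id id
  have hcard : A.ncard = h := by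
    rw [hvwc.2.2 A hA, Fintype.card_sum, Fintype.card_fin]
    lia
  have hinj : Set.InjOn π A := by
    rintro (a | a) ha (b | b) hb hab <;> obtain rfl : a = b := hab
    · rfl
    · exact absurd (hmatch a) (hA.1 ha hb (by simp))
    · exact absurd (hmatch a) (hA.1 hb ha (by simp))
    · rfl
  have himg : π '' A = Set.univ := by
    refine Set.eq_of_subset_of_ncard_le (Set.subset_univ _) ?_ Set.finite_univ
    rw [hinj.ncard_image, hcard, Set.ncard_univ, Nat.card_eq_fintype_card, Fintype.card_fin]
  obtain ⟨u, hu, huv⟩ : π v ∈ π '' A := himg ▸ Set.mem_univ _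
  rcases u with a | a <;> rcases v with b | b <;> obtain rfl : a = b := huv <;> simp [hu]

/-- In a very well-covered graph, neighbours of the two ends of a matching edge are adjacent. -/
theorem IsVeryWellCovered.adj_of_adj_of_adj_swap (hvwc : IsVeryWellCovered G)
    (hmatch : ∀ i : Fin h, G.Adj (Sum.inl i) (Sum.inr i)) {z z' v : Fin h ⊕ Fin h}
    (hz : G.Adj z v) (hz' : G.Adj z' v.swap) : G.Adj z z' := by
  by_contra hzz'
  have hind : IsIndepSet G {z, z'} := by
    rintro a (rfl | rfl) b (rfl | rfl) hab
    · exact absurd rfl hab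
    · exact hzz'
    · exact fun h ↦ hzz' h.symm
    · exact absurd rfl hab
  obtain ⟨A, hA, hsub⟩ := hind.exists_isMaxIndepSet
  rcases hA.mem_or_swap_mem hvwc hmatch v with hv | hv
  · exact hA.1 (hsub (by simp)) hv hz.ne hz
  · exact hA.1 (hsub (by simp)) hv hz'.ne hz'

theorem weight_matching_edge_eq_of_unmixed {K : Type*} [Field K] (hvwc : IsVeryWellCovered G)
    (hmatch : ∀ i : Fin h, G.Adj (Sum.inl i) (Sum.inr i))
    {w : Sym2 (Fin h ⊕ Fin h) → ℕ} (hw : ∀ e ∈ G.edgeSet, 0 < w e)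
    (hunm : IsUnmixedIdeal (weightedEdgeIdeal K G w)) {p s : Fin h ⊕ Fin h}
    (hps : G.Adj p s) (hps' : G.Adj s.swap p.swap) : w s(p, p.swap) = w s(p, s) := by
  have hswap : ∀ v : Fin h ⊕ Fin h, G.Adj v v.swap := by
    rintro (i | i)
    · exact hmatch i
    · exact (hmatch i).symm
  have hadj {z z' v : Fin h ⊕ Fin h} (hz : G.Adj z v) (hz' : G.Adj z' v.swap) : G.Adj z z' :=
    hvwc.adj_of_adj_of_adj_swap hmatch hz hz'
  have hqs : ¬ G.Adj p.swap s := fun hqs ↦ G.loopless.irrefl s (hadj hps.symm hqs.symm)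
  have hTs : ∀ a, ¬ G.Adj a p.swap → ¬ G.Adj a s := fun a ha has ↦ ha (hadj has hps'.symm)
  let T : Set (Fin h ⊕ Fin h) :=
    {v | v = p.swap ∨ v = s ∨ (G.Adj p v.swap ∧ ¬ G.Adj v p.swap)}
  have hT : IsIndepSet G T := by
    rintro a (rfl | rfl | ⟨ha, ha'⟩) b (rfl | rfl | ⟨hb, hb'⟩) hab habj
    · exact hab rfl
    · exact hqs habj
    · exact hb' habj.symm
    · exact hqs habj.symm
    · exact hab rfl
    · exact hTs b hb' habj.symm
    · exact ha' habj
    · exact hTs a ha' habj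
    · have hpb : G.Adj p b := hadj ha (by simpa using habj.symm)
      exact G.loopless.irrefl p (hadj hpb hb)
  obtain ⟨A, hA, hTA⟩ := hT.exists_isMaxIndepSet
  have hqA : p.swap ∈ A := hTA (Or.inl rfl)
  have hsA : s ∈ A := hTA (Or.inr (Or.inl rfl))
  have hpA : p ∉ A := fun hp ↦ hA.1 hp hqA (hswap p).ne (hswap p)
  have hnbr : ∀ t ∈ A, G.Adj p t → ∀ t' ∈ A, G.Adj p t' → G.Adj t.swap t' := by
    intro t ht hpt t' _ hpt'
    have htq : G.Adj t.swap p.swap := by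
      by_contra hcon
      exact hA.1 ht (hTA (Or.inr (Or.inr ⟨by simpa using hpt, hcon⟩))) (hswap t).ne (hswap t)
    exact (hadj hpt'.symm htq).symm
  have key : ∀ q ∈ A, G.Adj p q → ∀ t ∈ A, G.Adj p t → ¬ w s(p, q) < w s(p, t) := by
    intro q hq hpq t ht hpt hlt
    refine not_isUnmixedIdeal_of_lighter_edge (K := K) hw (A := A)
      (B := {b | b ∈ A ∧ (G.Adj p b → w s(p, q) < w s(p, b))}) hA.1 (fun b hb ↦ hb.1) ?_
      hpA hq hpq (fun b hb ↦ hb.2) hunm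
    intro c hc
    have hcA := (hA.mem_or_swap_mem hvwc hmatch c).resolve_left hc
    by_cases hpc : G.Adj p c.swap
    · exact ⟨t, ⟨ht, fun _ ↦ hlt⟩, by simpa using hnbr _ hcA hpc t ht hpt⟩
    · exact ⟨c.swap, ⟨hcA, fun h ↦ absurd h hpc⟩, hswap c⟩
  exact le_antisymm (not_lt.1 (key s hsA hps _ hqA (hswap p)))
    (not_lt.1 (key _ hqA (hswap p) s hsA hps))

end VeryWellCovered


/-- If `G` is a very well-covered graph labeled so that condition (*) holds and `w` is an
edge weight with `I(G_w)` unmixed, then `x_i y_j, x_j y_i ∈ E(G)` implies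
`w(x_i y_i) = w(x_j y_j) = w(x_i y_j) = w(x_j y_i)`. -/
theorem weight_eq_of_unmixed {h : ℕ} (K : Type*) [Field K]
    (G : SimpleGraph (Fin h ⊕ Fin h)) (hvwc : IsVeryWellCovered G) (hstar : CondStar G)
    (w : Sym2 (Fin h ⊕ Fin h) → ℕ) (hw : ∀ e ∈ G.edgeSet, 0 < w e)
    (hunm : IsUnmixedIdeal (weightedEdgeIdeal K G w))
    (i j : Fin h) (hij : i ≠ j)
    (e₁ : G.Adj (Sum.inl i) (Sum.inr j)) (e₂ : G.Adj (Sum.inl j) (Sum.inr i)) :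
    w s(Sum.inl i, Sum.inr i) = w s(Sum.inl j, Sum.inr j) ∧
      w s(Sum.inl i, Sum.inr i) = w s(Sum.inl i, Sum.inr j) ∧
      w s(Sum.inl i, Sum.inr i) = w s(Sum.inl j, Sum.inr i) := by
  have hmatch := hstar.2.2
  have hxi := weight_matching_edge_eq_of_unmixed hvwc hmatch hw hunm
    (p := Sum.inl i) (s := Sum.inr j) e₁ e₂
  have hyi := weight_matching_edge_eq_of_unmixed hvwc hmatch hw hunm
    (p := Sum.inr i) (s := Sum.inl j) e₂.symm e₁.symm
  have hxj := weight_matching_edge_eq_of_unmixed hvwc hmatch hw hunm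
    (p := Sum.inl j) (s := Sum.inr i) e₂ e₁
  simp only [Sum.swap_inl, Sum.swap_inr] at hxi hyi hxj
  rw [Sym2.eq_swap, Sym2.eq_swap (a := Sum.inr i)] at hyi
  exact ⟨hyi.trans hxj.symm, hxi, hyi⟩
end

section
/- Let G be an unmixed graph with 2h vertices, none of which is isolated, whose vertices are labeled so that condition (*) holds: V(G) is the disjoint union of the minimal vertex cover X = {x_1,…,x_h} and the maximal independent set Y = {y_1,…,y_h} with x_i y_i ∈ E(G) for all i. If G is Cohen-Macaulay, then there exists a permutation (i_1,…,i_h) of (1,…,h) such that, after simultaneously relabeling (x_{i_1},…,x_{i_h}) as (x_1,…,x_h) and (y_{i_1},…,y_{i_h}) as (y_1,…,y_h), one has: x_i y_j ∈ E(G) implies i ≤ j. -/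
universe u

open CategoryTheory in
/-- The Ext module `Ext_R^n(M, N)`. -/
noncomputable def ExtMod (R : Type u) [CommRing R] (n : ℕ) (M N : Type u)
    [AddCommGroup M] [Module R M] [AddCommGroup N] [Module R N] : ModuleCat R :=
  ((Ext R (ModuleCat R) n).obj (Opposite.op (ModuleCat.of R M))).obj (ModuleCat.of R N)

/-- The depth of a local ring `R`, defined via vanishing of the Ext modules
`Ext_R^n(k, R)`, where `k` is the residue field of `R`. -/
noncomputable def localRingDepth (R : Type u) [CommRing R] [IsLocalRing R] : ℕ∞ :=
  sInf {n : ℕ∞ | ∃ m : ℕ, n = m ∧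
    Nontrivial (ExtMod R m (IsLocalRing.ResidueField R) R)}

/-- A commutative ring is Cohen-Macaulay if for every maximal ideal `p`, the depth of the
localization at `p` equals its Krull dimension. -/
def IsCohenMacaulayRing (R : Type u) [CommRing R] : Prop :=
  ∀ (p : Ideal R) [p.IsMaximal],
    (localRingDepth (Localization.AtPrime p) : WithBot ℕ∞) =
      ringKrullDim (Localization.AtPrime p)

/-- The (unweighted) edge ideal `I(G)` of a graph, generated by the monomials `X u * X v`
for the edges `uv` of `G`. -/
noncomputable def edgeIdeal {V : Type*} (K : Type*) [CommSemiring K]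
    (G : SimpleGraph V) : Ideal (MvPolynomial V K) :=
  Ideal.span ((fun e => Sym2.lift ⟨fun u v => MvPolynomial.X u * MvPolynomial.X v,
    fun u v => mul_comm _ _⟩ e) '' G.edgeSet)

/-- A graph is unmixed if all its minimal vertex covers have the same cardinality. -/
def IsUnmixedGraph {V : Type*} (G : SimpleGraph V) : Prop :=
  ∀ C₁ C₂ : Set V, IsMinVertexCover G C₁ → IsMinVertexCover G C₂ → C₁.ncard = C₂.ncard

open CategoryTheory in
/-- Every degree `n` cocycle of the complex `Hom(C, M)` is a coboundary. -/
def HomCocyclesAreCoboundaries {A : Type u} [CommRing A] (C : ChainComplex (ModuleCat.{u} A) ℕ)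
    (n : ℕ) (M : Type u) [AddCommGroup M] [Module A M] : Prop :=
  ∀ f : C.X n →ₗ[A] M, f ∘ₗ (C.d (n + 1) n).hom = 0 →
    ∃ (j : ℕ) (g : C.X j →ₗ[A] M), f = g ∘ₗ (C.d n j).hom

namespace HomCocyclesAreCoboundaries

variable {A : Type u} [CommRing A] {C : ChainComplex (ModuleCat.{u} A) ℕ} {n : ℕ}
  {M N L : Type u} [AddCommGroup M] [Module A M] [AddCommGroup N] [Module A N]
  [AddCommGroup L] [Module A L]

theorem exists_succ (hM : HomCocyclesAreCoboundaries C (n + 1) M) (f : C.X (n + 1) →ₗ[A] M)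
    (hf : f ∘ₗ (C.d (n + 2) (n + 1)).hom = 0) :
    ∃ g : C.X n →ₗ[A] M, f = g ∘ₗ (C.d (n + 1) n).hom := by
  obtain ⟨j, g, rfl⟩ := hM f hf
  by_cases hj : j = n
  · subst hj
    exact ⟨g, rfl⟩
  · refine ⟨0, ?_⟩
    rw [C.shape (n + 1) j (by simpa using hj)]
    simp

theorem of_equiv (hM : HomCocyclesAreCoboundaries C n M) (e : M ≃ₗ[A] N) :
    HomCocyclesAreCoboundaries C n N := by
  intro f hf
  obtain ⟨j, g, hg⟩ := hM (e.symm.toLinearMap ∘ₗ f) (by rw [LinearMap.comp_assoc, hf]; simp)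
  refine ⟨j, e.toLinearMap ∘ₗ g, ?_⟩
  rw [LinearMap.comp_assoc, ← hg]
  ext x
  simp

/-- The piece `Ext^n(k, N) → Ext^n(k, L) → Ext^{n+1}(k, M)` of the long exact sequence. -/
theorem of_shortExact (hC : Module.Projective A (C.X n))
    (hM : HomCocyclesAreCoboundaries C (n + 1) M) (hN : HomCocyclesAreCoboundaries C n N)
    (i : M →ₗ[A] N) (p : N →ₗ[A] L) (hi : Function.Injective i) (hp : Function.Surjective p)
    (hip : Function.Exact i p) : HomCocyclesAreCoboundaries C n L := by
  intro f hf
  obtain ⟨g, rfl⟩ := Module.projective_lifting_property p f hp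
  have hrange : ∀ x, (g ∘ₗ (C.d (n + 1) n).hom) x ∈ LinearMap.range i := fun x =>
    (hip _).1 (LinearMap.congr_fun hf x)
  let e := LinearEquiv.ofInjective i hi
  let u : C.X (n + 1) →ₗ[A] M := e.symm.toLinearMap ∘ₗ LinearMap.codRestrict _ _ hrange
  have hu : i ∘ₗ u = g ∘ₗ (C.d (n + 1) n).hom := by
    ext x
    exact congrArg Subtype.val (e.apply_symm_apply (LinearMap.codRestrict _ _ hrange x))
  have hdd : (C.d (n + 1) n).hom ∘ₗ (C.d (n + 2) (n + 1)).hom = 0 := by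
    rw [← ModuleCat.hom_comp, C.d_comp_d]
    rfl
  obtain ⟨v, hv⟩ := hM.exists_succ u (by
    ext x
    refine hi ?_
    have := LinearMap.congr_fun hu ((C.d (n + 2) (n + 1)).hom x)
    have h2 := LinearMap.congr_fun hdd x
    simp only [LinearMap.comp_apply] at this h2 ⊢
    rw [this, h2]
    simp)
  obtain ⟨j, w, hw⟩ := hN (g - i ∘ₗ v) (by
    rw [LinearMap.sub_comp, LinearMap.comp_assoc, ← hv, hu, sub_self])
  refine ⟨j, p ∘ₗ w, ?_⟩
  rw [LinearMap.comp_assoc, ← hw, LinearMap.comp_sub, ← LinearMap.comp_assoc, hip.linearMap_comp_eq_zero]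
  simp

end HomCocyclesAreCoboundaries

section Resolution

open CategoryTheory

variable {A : Type u} [CommRing A] {k M : Type u} [AddCommGroup k] [Module A k]
  [AddCommGroup M] [Module A M] (P : ProjectiveResolution (ModuleCat.of A k))

theorem homCocyclesAreCoboundaries_of_subsingleton_ext (n : ℕ)
    (h : ¬ Nontrivial (ExtMod A n k M)) : HomCocyclesAreCoboundaries P.complex n M := by
  intro f hf
  have hsub : Subsingleton (ExtMod A n k M) := not_nontrivial_iff_subsingleton.1 h
  have hz : Limits.IsZero ((P.complex.linearYonedaObj A (ModuleCat.of A M)).homology n) :=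
    (ModuleCat.isZero_of_subsingleton (ExtMod A n k M)).of_iso (P.isoExt n _).symm
  rw [← HomologicalComplex.exactAt_iff_isZero_homology, HomologicalComplex.exactAt_iff' _
    ((ComplexShape.up ℕ).prev n) n (n + 1) rfl (by simp), ShortComplex.moduleCat_exact_iff] at hz
  obtain ⟨g, hg⟩ := hz (ModuleCat.ofHom f) (by
    refine ModuleCat.hom_ext ?_
    exact hf)
  refine ⟨(ComplexShape.up ℕ).prev n, ModuleCat.Hom.hom g, ?_⟩
  exact (congrArg ModuleCat.Hom.hom hg).symm

/-- A projective resolution of `k` ends in a surjection onto `k`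
whose kernel is the image of the first differential. -/
theorem exists_augmentation : ∃ ε : P.complex.X 0 →ₗ[A] k, Function.Surjective ε ∧
    Function.Exact (P.complex.d 1 0).hom ε := by
  refine ⟨(P.π.f 0).hom, ?_, ?_⟩
  · have : Epi (P.π.f 0) := inferInstance
    exact (ModuleCat.epi_iff_surjective _).1 this
  · have := P.exact₀
    rw [ShortComplex.moduleCat_exact_iff] at this
    intro x
    refine ⟨fun hx => this x hx, ?_⟩
    rintro ⟨y, rfl⟩
    exact LinearMap.congr_fun (congrArg ModuleCat.Hom.hom P.complex_d_comp_π_f_zero) y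

theorem projective_X (n : ℕ) : Module.Projective A (P.complex.X n) :=
  (IsProjective.iff_projective _).2 (P.projective n)

theorem not_homCocyclesAreCoboundaries_zero_self [Nontrivial k] :
    ¬ HomCocyclesAreCoboundaries P.complex 0 k := by
  intro h
  obtain ⟨ε, hsurj, hex⟩ := exists_augmentation P
  obtain ⟨j, g, hg⟩ := h ε hex.linearMap_comp_eq_zero
  obtain ⟨y, hy⟩ := exists_ne (0 : k)
  obtain ⟨x, rfl⟩ := hsurj y
  rw [hg, P.complex.shape 0 j (by simp)] at hy
  simp at hy

theorem homCocyclesAreCoboundaries_zero (I : Ideal A) (hI : ∀ a ∈ I, ∀ x : k, a • x = 0)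
    (hM : ∀ x : M, (∀ a ∈ I, a • x = 0) → x = 0) : HomCocyclesAreCoboundaries P.complex 0 M := by
  intro f hf
  obtain ⟨ε, -, hex⟩ := exists_augmentation P
  refine ⟨0, 0, ?_⟩
  ext x
  refine hM _ fun a ha => ?_
  obtain ⟨y, hy⟩ := (hex (a • x)).1 (by rw [map_smul, hI a ha])
  rw [← map_smul, ← hy]
  exact LinearMap.congr_fun hf y

end Resolution

section Quotients

open CategoryTheory

variable {A : Type u} [CommRing A]

theorem HomCocyclesAreCoboundaries.quotient_sup_span_singleton {C : ChainComplex (ModuleCat.{u} A) ℕ}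
    {n : ℕ} (hC : Module.Projective A (C.X n)) {J J' : Ideal A} {t : A}
    (hJ' : J' = J ⊔ Ideal.span {t}) (ht : ∀ a, t * a ∈ J → a ∈ J)
    (h₁ : HomCocyclesAreCoboundaries C (n + 1) (A ⧸ J))
    (h₀ : HomCocyclesAreCoboundaries C n (A ⧸ J)) :
    HomCocyclesAreCoboundaries C n (A ⧸ J') := by
  have hle : J ≤ J' := hJ' ▸ le_sup_left
  refine h₁.of_shortExact hC h₀ (LinearMap.lsmul A (A ⧸ J) t) (Submodule.factor hle) ?_ ?_ ?_
  · refine (injective_iff_map_eq_zero _).2 fun x hx => ?_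
    obtain ⟨a, rfl⟩ := Ideal.Quotient.mk_surjective x
    exact Ideal.Quotient.eq_zero_iff_mem.2 (ht a (Ideal.Quotient.eq_zero_iff_mem.1 hx))
  · exact Submodule.factor_surjective hle
  · intro x
    obtain ⟨a, rfl⟩ := Ideal.Quotient.mk_surjective x
    constructor
    · intro hx
      have ha : a ∈ J' := Ideal.Quotient.eq_zero_iff_mem.1 hx
      rw [hJ', Submodule.mem_sup] at ha
      obtain ⟨b, hb, d, hd, rfl⟩ := ha
      obtain ⟨r, rfl⟩ := Ideal.mem_span_singleton'.1 hd
      refine ⟨Ideal.Quotient.mk J r, Ideal.Quotient.eq.2 ?_⟩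
      have : t * r - (b + r * t) = -b := by ring
      exact this ▸ J.neg_mem hb
    · rintro ⟨y, hy⟩
      obtain ⟨b, rfl⟩ := Ideal.Quotient.mk_surjective y
      rw [← hy]
      refine Ideal.Quotient.eq_zero_iff_mem.2 ?_
      rw [hJ']
      exact Ideal.mem_sup_right (Ideal.mul_mem_right _ _ (Ideal.mem_span_singleton_self t))

/-- If `J₁` and `J₂` add up to `m`, which is not associated to either quotient,
then `Ext^1(A ⧸ m, A ⧸ (J₁ ⊓ J₂)) ≠ 0`, as witnessed by the sequence
`0 → A ⧸ (J₁ ⊓ J₂) → A ⧸ J₁ × A ⧸ J₂ → A ⧸ m → 0`. -/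
theorem not_homCocyclesAreCoboundaries_one_quotient_inf {m J₁ J₂ : Ideal A} [Nontrivial (A ⧸ m)]
    (P : ProjectiveResolution (ModuleCat.of A (A ⧸ m))) (hsup : J₁ ⊔ J₂ = m)
    (h₁ : ∀ a, (∀ b ∈ m, b * a ∈ J₁) → a ∈ J₁) (h₂ : ∀ a, (∀ b ∈ m, b * a ∈ J₂) → a ∈ J₂) :
    ¬ HomCocyclesAreCoboundaries P.complex 1 (A ⧸ (J₁ ⊓ J₂)) := by
  intro h
  have hle₁ : J₁ ≤ m := hsup ▸ le_sup_left
  have hle₂ : J₂ ≤ m := hsup ▸ le_sup_right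
  have hN : HomCocyclesAreCoboundaries P.complex 0 ((A ⧸ J₁) × (A ⧸ J₂)) := by
    refine homCocyclesAreCoboundaries_zero P m ?_ ?_
    · intro a ha x
      obtain ⟨b, rfl⟩ := Ideal.Quotient.mk_surjective x
      exact Ideal.Quotient.eq_zero_iff_mem.2 (m.mul_mem_right b ha)
    · rintro ⟨x, y⟩ hxy
      obtain ⟨b, rfl⟩ := Ideal.Quotient.mk_surjective x
      obtain ⟨d, rfl⟩ := Ideal.Quotient.mk_surjective y
      refine Prod.ext (Ideal.Quotient.eq_zero_iff_mem.2 (h₁ b fun a ha => ?_))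
        (Ideal.Quotient.eq_zero_iff_mem.2 (h₂ d fun a ha => ?_))
      · exact Ideal.Quotient.eq_zero_iff_mem.1 (congrArg Prod.fst (hxy a ha))
      · exact Ideal.Quotient.eq_zero_iff_mem.1 (congrArg Prod.snd (hxy a ha))
  refine not_homCocyclesAreCoboundaries_zero_self P (h.of_shortExact (projective_X P 0) hN
    ((Submodule.factor inf_le_left).prod (Submodule.factor inf_le_right))
    ((Submodule.factor hle₁).coprod (-(Submodule.factor hle₂))) ?_ ?_ ?_)
  · refine (injective_iff_map_eq_zero _).2 fun x hx => ?_
    obtain ⟨a, rfl⟩ := Ideal.Quotient.mk_surjective x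
    exact Ideal.Quotient.eq_zero_iff_mem.2
      ⟨Ideal.Quotient.eq_zero_iff_mem.1 (congrArg Prod.fst hx),
        Ideal.Quotient.eq_zero_iff_mem.1 (congrArg Prod.snd hx)⟩
  · intro x
    obtain ⟨y, hy⟩ := Submodule.factor_surjective hle₁ x
    exact ⟨(y, 0), by simp [hy]⟩
  · rintro ⟨x, y⟩
    obtain ⟨b, rfl⟩ := Ideal.Quotient.mk_surjective x
    obtain ⟨d, rfl⟩ := Ideal.Quotient.mk_surjective y
    constructor
    · intro hx
      rw [LinearMap.coprod_apply, LinearMap.neg_apply, ← sub_eq_add_neg] at hx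
      have hbd : b - d ∈ J₁ ⊔ J₂ := by
        rw [hsup]
        exact Ideal.Quotient.eq.1 (sub_eq_zero.1 hx)
      obtain ⟨e, he, f, hf, hef⟩ := Submodule.mem_sup.1 hbd
      refine ⟨Ideal.Quotient.mk _ (b - e), Prod.ext (Ideal.Quotient.eq.2 ?_)
        (Ideal.Quotient.eq.2 ?_)⟩
      · have : b - e - b = -e := by ring
        exact this ▸ J₁.neg_mem he
      · have : b - e - d = f := by linear_combination -hef
        exact this ▸ hf
    · rintro ⟨z, hz⟩
      obtain ⟨a, rfl⟩ := Ideal.Quotient.mk_surjective z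
      rw [← hz]
      exact add_neg_cancel (Ideal.Quotient.mk m a)

end Quotients

section PartialEval

open MvPolynomial

theorem X_mul_X_mem_edgeIdeal {V : Type*} {K : Type u} [Field K] {G : SimpleGraph V}
    {u v : V} (h : G.Adj u v) :
    X u * X v ∈ edgeIdeal K G :=
  Ideal.subset_span ⟨s(u, v), h, rfl⟩

variable {V : Type*} [DecidableEq V] {K : Type u} [Field K]

/-- Evaluation at the point `c` of all variables outside `W`. -/
noncomputable def partialEval (c : V → K) (W : Finset V) :
    MvPolynomial V K →ₐ[K] MvPolynomial V K :=
  aeval fun v => if v ∈ W then X v else C (c v)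

/-- The prime ideal generated by the `X v - c v` with `v ∉ W`. -/
noncomputable def linearIdeal (c : V → K) (W : Finset V) : Ideal (MvPolynomial V K) :=
  RingHom.ker (partialEval c W)

variable (c : V → K)

theorem mem_linearIdeal {W : Finset V} {f : MvPolynomial V K} :
    f ∈ linearIdeal c W ↔ partialEval c W f = 0 := Iff.rfl

instance (W : Finset V) : (linearIdeal c W).IsPrime := RingHom.ker_isPrime _

theorem partialEval_partialEval (W W' : Finset V) (f : MvPolynomial V K) :
    partialEval c W (partialEval c W' f) = partialEval c (W ∩ W') f := by
  suffices h : (partialEval c W).comp (partialEval c W') = partialEval c (W ∩ W') from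
    DFunLike.congr_fun h f
  refine algHom_ext fun v => ?_
  by_cases h' : v ∈ W' <;> by_cases h : v ∈ W <;> simp [partialEval, h, h']

theorem partialEval_empty (f : MvPolynomial V K) : partialEval c ∅ f = C (eval c f) := by
  suffices h : partialEval c ∅ = (Algebra.ofId K _).comp (aeval c) by
    rw [h]
    simp [Algebra.ofId_apply, aeval_eq_eval, algebraMap_eq]
  refine algHom_ext fun v => ?_
  simp [partialEval, Algebra.ofId_apply, algebraMap_eq]

theorem mem_linearIdeal_empty {f : MvPolynomial V K} : f ∈ linearIdeal c ∅ ↔ eval c f = 0 := by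
  rw [mem_linearIdeal, partialEval_empty, C_eq_zero]

theorem X_sub_C_mem_linearIdeal {W : Finset V} {v : V} :
    X v - C (c v) ∈ linearIdeal c W ↔ v ∉ W := by
  rw [mem_linearIdeal]
  by_cases h : v ∈ W
  · simp only [partialEval, map_sub, aeval_X, h, if_true, algHom_C, not_true_eq_false, iff_false,
      algebraMap_eq]
    intro h0
    have := congrArg (coeff (Finsupp.single v 1)) h0
    rw [coeff_sub, coeff_X, coeff_C, if_neg (Finsupp.single_ne_zero.2 one_ne_zero).symm] at this
    simp at this
  · simp [partialEval, h, algebraMap_eq]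

theorem linearIdeal_eq_span (W : Finset V) :
    linearIdeal c W = Ideal.span {f | ∃ v ∉ W, f = X v - C (c v)} := by
  refine le_antisymm (fun f hf => ?_) (Ideal.span_le.2 ?_)
  · let J : Ideal (MvPolynomial V K) := Ideal.span {f | ∃ v ∉ W, f = X v - C (c v)}
    have h : (Ideal.Quotient.mkₐ K J).comp (partialEval c W) = Ideal.Quotient.mkₐ K J := by
      refine algHom_ext fun v => ?_
      by_cases h : v ∈ W
      · simp [partialEval, h]
      · simp only [partialEval, AlgHom.comp_apply, aeval_X, h, if_false]
        have hJ : X v - C (c v) ∈ J := Ideal.subset_span ⟨v, h, rfl⟩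
        exact (Ideal.Quotient.eq.2 hJ).symm
    have hf' := DFunLike.congr_fun h f
    rw [AlgHom.comp_apply, (mem_linearIdeal c).1 hf, map_zero] at hf'
    exact Ideal.Quotient.eq_zero_iff_mem.1 hf'.symm
  · rintro _ ⟨v, hv, rfl⟩
    exact (X_sub_C_mem_linearIdeal c).2 hv

theorem linearIdeal_anti {W W' : Finset V} (h : W ⊆ W') : linearIdeal c W' ≤ linearIdeal c W := by
  rw [linearIdeal_eq_span c W', Ideal.span_le]
  rintro _ ⟨v, hv, rfl⟩
  exact (X_sub_C_mem_linearIdeal c).2 fun hW => hv (h hW)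

theorem linearIdeal_sup (W W' : Finset V) :
    linearIdeal c W ⊔ linearIdeal c W' = linearIdeal c (W ∩ W') := by
  refine le_antisymm (sup_le (linearIdeal_anti c Finset.inter_subset_left)
    (linearIdeal_anti c Finset.inter_subset_right)) ?_
  rw [linearIdeal_eq_span c (W ∩ W'), Ideal.span_le]
  rintro _ ⟨v, hv, rfl⟩
  by_cases h : v ∈ W
  · exact Ideal.mem_sup_right ((X_sub_C_mem_linearIdeal c).2 fun h' => hv (Finset.mem_inter.2 ⟨h, h'⟩))
  · exact Ideal.mem_sup_left ((X_sub_C_mem_linearIdeal c).2 h)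

theorem linearIdeal_erase_inf_le [Finite V] (W₁ W₂ : Finset V) (v : V) :
    linearIdeal c (W₁.erase v) ⊓ linearIdeal c (W₂.erase v) ≤
      linearIdeal c W₁ ⊓ linearIdeal c W₂ ⊔ Ideal.span {X v - C (c v)} := by
  cases nonempty_fintype V
  rintro f ⟨h₁, h₂⟩
  have hsub : f - partialEval c (Finset.univ.erase v) f ∈ Ideal.span {X v - C (c v)} := by
    have : f - partialEval c (Finset.univ.erase v) f ∈ linearIdeal c (Finset.univ.erase v) := by
      rw [mem_linearIdeal, map_sub, partialEval_partialEval, Finset.inter_self, sub_self]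
    rw [linearIdeal_eq_span] at this
    simpa using this
  have hmem : ∀ W : Finset V, f ∈ linearIdeal c (W.erase v) →
      partialEval c (Finset.univ.erase v) f ∈ linearIdeal c W := by
    intro W hW
    rw [mem_linearIdeal, partialEval_partialEval, Finset.inter_erase, Finset.inter_univ]
    exact hW
  rw [← sub_add_cancel f (partialEval c (Finset.univ.erase v) f)]
  exact add_mem (Ideal.mem_sup_right hsub) (Ideal.mem_sup_left ⟨hmem W₁ h₁, hmem W₂ h₂⟩)

theorem mem_linearIdeal_of_mul_mem {W : Finset V} {u f : MvPolynomial V K} (hu : eval c u ≠ 0)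
    (h : u * f ∈ linearIdeal c W) : f ∈ linearIdeal c W := by
  refine (Ideal.IsPrime.mem_or_mem inferInstance h).resolve_left fun hW => hu ?_
  exact (mem_linearIdeal_empty c).1 (linearIdeal_anti c (Finset.empty_subset W) hW)

theorem linearIdeal_eq_span_X {W : Finset V} (hc : ∀ v ∉ W, c v = 0) :
    linearIdeal c W = Ideal.span (X '' {v | v ∉ W}) := by
  rw [linearIdeal_eq_span]
  congr 1
  ext f
  constructor
  · rintro ⟨v, hv, rfl⟩
    exact ⟨v, hv, by simp [hc v hv]⟩
  · rintro ⟨v, hv, rfl⟩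
    exact ⟨v, hv, by simp [hc v hv]⟩

variable {c} {G : SimpleGraph V}

theorem edgeIdeal_le_linearIdeal {W : Finset V} (hW : IsIndepSet G W) (hc : ∀ v ∉ W, c v = 0) :
    edgeIdeal K G ≤ linearIdeal c W := by
  refine Ideal.span_le.2 ?_
  rintro _ ⟨e, he, rfl⟩
  induction e using Sym2.ind with
  | _ u v =>
    have hX : ∀ w ∉ W, (X w : MvPolynomial V K) ∈ linearIdeal c W := fun w hw => by
      simpa [hc w hw] using (X_sub_C_mem_linearIdeal c).2 hw
    by_cases hu : u ∈ W
    · by_cases hv : v ∈ W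
      · exact absurd he (hW hu hv (SimpleGraph.Adj.ne he))
      · exact Ideal.mul_mem_left _ _ (hX v hv)
    · exact Ideal.mul_mem_right _ _ (hX u hu)

/-- Near a point whose support is `M₁ ∩ M₂`, the edge ideal is the intersection
of the two primes belonging to `M₁` and `M₂`. -/
theorem prod_X_mul_mem_edgeIdeal {M₁ M₂ : Finset V} (hc₁ : ∀ v ∉ M₁, c v = 0)
    (hc₂ : ∀ v ∉ M₂, c v = 0) (hout : ∀ u ∉ M₁, u ∉ M₂ → ∃ w ∈ M₁ ∩ M₂, G.Adj u w)
    (hcross : ∀ u ∈ M₁ \ M₂, ∀ v ∈ M₂ \ M₁, G.Adj u v) {f : MvPolynomial V K}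
    (hf : f ∈ linearIdeal c M₁ ⊓ linearIdeal c M₂) :
    (∏ w ∈ M₁ ∩ M₂, X w) * f ∈ edgeIdeal K G := by
  obtain ⟨h₁, h₂⟩ := hf
  rw [linearIdeal_eq_span_X c hc₁] at h₁
  rw [linearIdeal_eq_span_X c hc₂] at h₂
  have h₁ := mem_ideal_span_X_image.1 h₁
  have h₂ := mem_ideal_span_X_image.1 h₂
  rw [f.as_sum, Finset.mul_sum]
  refine sum_mem fun m hm => ?_
  obtain ⟨u, hu, hmu⟩ := h₁ m hm
  obtain ⟨v, hv, hmv⟩ := h₂ m hm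
  have hX : ∀ w, m w ≠ 0 → (X w : MvPolynomial V K) ∣ monomial m (coeff m f) := fun w hw => by
    rw [X_dvd_monomial]
    exact Or.inr hw
  have houter : ∀ w, m w ≠ 0 → w ∉ M₁ → w ∉ M₂ →
      (∏ w ∈ M₁ ∩ M₂, X w) * monomial m (coeff m f) ∈ edgeIdeal K G := by
    intro w hw hw₁ hw₂
    obtain ⟨z, hz, hadj⟩ := hout w hw₁ hw₂
    refine Ideal.mem_of_dvd _ ?_ (X_mul_X_mem_edgeIdeal hadj.symm)
    exact mul_dvd_mul (Finset.dvd_prod_of_mem _ hz) (hX w hw)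
  by_cases hu₂ : u ∈ M₂
  · by_cases hv₁ : v ∈ M₁
    · refine Ideal.mul_mem_left _ _ (Ideal.mem_of_dvd _ ?_ (X_mul_X_mem_edgeIdeal
        (hcross v (Finset.mem_sdiff.2 ⟨hv₁, hv⟩) u (Finset.mem_sdiff.2 ⟨hu₂, hu⟩))))
      have huv : u ≠ v := fun h => hu (h ▸ hv₁)
      rw [X, X, monomial_mul, monomial_dvd_monomial]
      refine ⟨Or.inr fun w => ?_, by simp⟩
      by_cases hwv : v = w
      · subst hwv
        simp [huv]
        omega
      · by_cases hwu : u = w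
        · subst hwu
          simp [huv.symm]
          omega
        · simp [hwv, hwu]
    · exact houter v hmv hv₁ hv
  · exact houter u hmu hu hu₂

end PartialEval

section LocalizationAtPoint

open MvPolynomial

variable {V : Type*} {K : Type u} [Field K] {A : Type*} [CommRing A]

/-- The ring `A` is the localization of `K[V] ⧸ I` at the point `c`. -/
structure IsLocalizationAtPoint (I : Ideal (MvPolynomial V K)) (c : V → K)
    (ι : MvPolynomial V K →+* A) : Prop where
  isUnit : ∀ u, eval c u ≠ 0 → IsUnit (ι u)
  surj : ∀ a, ∃ s u, eval c u ≠ 0 ∧ a * ι u = ι s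
  eq_zero_iff : ∀ s, ι s = 0 ↔ ∃ u, eval c u ≠ 0 ∧ u * s ∈ I

theorem isLocalizationAtPoint_atPrime (I : Ideal (MvPolynomial V K)) (c : V → K)
    (p : Ideal (MvPolynomial V K ⧸ I)) [p.IsPrime]
    (hp : ∀ f, Ideal.Quotient.mk I f ∈ p ↔ eval c f = 0) :
    IsLocalizationAtPoint (A := Localization.AtPrime p) I c
      ((algebraMap (MvPolynomial V K ⧸ I) (Localization.AtPrime p)).comp
        (Ideal.Quotient.mk I)) where
  isUnit u hu := IsLocalization.map_units (M := p.primeCompl) (Localization.AtPrime p)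
    ⟨Ideal.Quotient.mk I u, fun h => hu ((hp u).1 h)⟩
  surj a := by
    obtain ⟨⟨s, u, hu⟩, h⟩ := IsLocalization.surj p.primeCompl a
    obtain ⟨s, rfl⟩ := Ideal.Quotient.mk_surjective s
    obtain ⟨u, rfl⟩ := Ideal.Quotient.mk_surjective u
    exact ⟨s, u, fun h => hu ((hp u).2 h), h⟩
  eq_zero_iff s := by
    rw [RingHom.comp_apply, IsLocalization.map_eq_zero_iff p.primeCompl]
    constructor
    · rintro ⟨⟨u, hu⟩, h⟩
      obtain ⟨u, rfl⟩ := Ideal.Quotient.mk_surjective u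
      refine ⟨u, fun h => hu ((hp u).2 h), Ideal.Quotient.eq_zero_iff_mem.1 ?_⟩
      rw [map_mul]
      exact h
    · rintro ⟨u, hu, h⟩
      refine ⟨⟨Ideal.Quotient.mk I u, fun h => hu ((hp u).1 h)⟩, ?_⟩
      rw [← map_mul]
      exact Ideal.Quotient.eq_zero_iff_mem.2 h

namespace IsLocalizationAtPoint

variable {I : Ideal (MvPolynomial V K)} {c : V → K} {ι : MvPolynomial V K →+* A}

theorem mem_map_iff (hι : IsLocalizationAtPoint I c ι) {Q : Ideal (MvPolynomial V K)} (hIQ : I ≤ Q)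
    (hQ : ∀ u f, eval c u ≠ 0 → u * f ∈ Q → f ∈ Q) {a : A} {s u : MvPolynomial V K}
    (hu : eval c u ≠ 0) (h : a * ι u = ι s) : a ∈ Q.map ι ↔ s ∈ Q := by
  constructor
  · intro ha
    have key : ∃ s' ∈ Q, ∃ u', eval c u' ≠ 0 ∧ a * ι u' = ι s' := by
      clear h
      induction ha using Submodule.span_induction with
      | mem x hx =>
        obtain ⟨f, hf, rfl⟩ := hx
        exact ⟨f, hf, 1, by simp, by simp⟩
      | zero => exact ⟨0, Q.zero_mem, 1, by simp, by simp⟩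
      | add x y _ _ hx hy =>
        obtain ⟨f, hf, v, hv, hfv⟩ := hx
        obtain ⟨g, hg, w, hw, hgw⟩ := hy
        refine ⟨w * f + v * g, add_mem (Q.mul_mem_left _ hf) (Q.mul_mem_left _ hg), v * w,
          by simp [hv, hw], ?_⟩
        simp only [map_mul, map_add, ← hfv, ← hgw]
        ring
      | smul b x _ hx =>
        obtain ⟨f, hf, v, hv, hfv⟩ := hx
        obtain ⟨r, w, hw, hrw⟩ := hι.surj b
        refine ⟨r * f, Q.mul_mem_left _ hf, v * w, by simp [hv, hw], ?_⟩
        simp only [map_mul, ← hfv, ← hrw, smul_eq_mul]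
        ring
    obtain ⟨s', hs', u', hu', h'⟩ := key
    have h0 : ι (s' * u - s * u') = 0 := by
      simp only [map_sub, map_mul, ← h', ← h]
      ring
    obtain ⟨w, hw, hwI⟩ := (hι.eq_zero_iff _).1 h0
    have := hQ w _ hw (hIQ hwI)
    have h2 : u' * s = s' * u - (s' * u - s * u') := by ring
    exact hQ u' s hu' (h2 ▸ sub_mem (Q.mul_mem_right _ hs') this)
  · intro hs
    rw [← Ideal.mul_unit_mem_iff_mem _ (hι.isUnit u hu), h]
    exact Ideal.mem_map_of_mem ι hs

theorem apply_mem_map_iff (hι : IsLocalizationAtPoint I c ι) {Q : Ideal (MvPolynomial V K)}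
    (hIQ : I ≤ Q) (hQ : ∀ u f, eval c u ≠ 0 → u * f ∈ Q → f ∈ Q) {s : MvPolynomial V K} :
    ι s ∈ Q.map ι ↔ s ∈ Q :=
  hι.mem_map_iff hIQ hQ (u := 1) (by simp) (by simp)

theorem isPrime_map (hι : IsLocalizationAtPoint I c ι) {Q : Ideal (MvPolynomial V K)} (hIQ : I ≤ Q)
    (hQ : ∀ u f, eval c u ≠ 0 → u * f ∈ Q → f ∈ Q) [hprime : Q.IsPrime] :
    (Q.map ι).IsPrime := by
  refine ⟨fun h => hprime.ne_top ?_, fun {a b} hab => ?_⟩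
  · rw [Ideal.eq_top_iff_one, ← map_one ι, hι.apply_mem_map_iff hIQ hQ] at h
    exact Q.eq_top_of_isUnit_mem h isUnit_one
  · obtain ⟨s, u, hu, hs⟩ := hι.surj a
    obtain ⟨r, v, hv, hr⟩ := hι.surj b
    rw [hι.mem_map_iff hIQ hQ hu hs, hι.mem_map_iff hIQ hQ hv hr]
    refine hprime.mem_or_mem ((hι.mem_map_iff hIQ hQ (u := u * v) (by simp [hu, hv]) ?_).1 hab)
    rw [map_mul, map_mul, ← hs, ← hr]
    ring

end IsLocalizationAtPoint

end LocalizationAtPoint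

section DepthAndDimension

open MvPolynomial CategoryTheory

namespace IsLocalizationAtPoint

theorem card_le_ringKrullDim {V : Type*} [DecidableEq V] {K : Type u} [Field K] {A : Type*}
    [CommRing A] {I : Ideal (MvPolynomial V K)} {c : V → K} {ι : MvPolynomial V K →+* A}
    (hι : IsLocalizationAtPoint I c ι) {M : Finset V} (hM : I ≤ linearIdeal c M) :
    (M.card : WithBot ℕ∞) ≤ ringKrullDim A := by
  have hle : ∀ W ⊆ M, I ≤ linearIdeal c W := fun W hW => hM.trans (linearIdeal_anti c hW)
  have hsat : ∀ W : Finset V, ∀ u f, eval c u ≠ 0 → u * f ∈ linearIdeal c W → f ∈ linearIdeal c W :=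
    fun W u f => mem_linearIdeal_of_mul_mem c
  have hprime : ∀ W ⊆ M, ((linearIdeal c W).map ι).IsPrime := fun W hW =>
    hι.isPrime_map (hle W hW) (hsat W)
  have key : ∀ W (hW : W ⊆ M), (W.card : ℕ∞) ≤
      Order.coheight (⟨(linearIdeal c W).map ι, hprime W hW⟩ : PrimeSpectrum A) := by
    intro W
    induction W using Finset.induction_on with
    | empty => simp
    | insert v W hv ih =>
      intro hW
      have hW' : W ⊆ M := (Finset.subset_insert v W).trans hW
      have hlt : (⟨(linearIdeal c (insert v W)).map ι, hprime _ hW⟩ : PrimeSpectrum A) <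
          ⟨(linearIdeal c W).map ι, hprime W hW'⟩ := by
        refine lt_of_le_not_ge (Ideal.map_mono (linearIdeal_anti c (Finset.subset_insert v W)))
          fun h => ?_
        have hmem := (hι.apply_mem_map_iff (hle W hW') (hsat W)).2
          ((X_sub_C_mem_linearIdeal c).2 hv)
        have := (hι.apply_mem_map_iff (hle _ hW) (hsat _)).1 (h hmem)
        exact (X_sub_C_mem_linearIdeal c).1 this (Finset.mem_insert_self v W)
      rw [Finset.card_insert_of_notMem hv, Nat.cast_succ]
      exact (add_le_add_left (ih hW') 1).trans (Order.coheight_add_one_le hlt)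
  refine le_trans ?_ (Order.coheight_le_krullDim (⟨_, hprime M subset_rfl⟩ : PrimeSpectrum A))
  exact_mod_cast key M subset_rfl

variable {V : Type*} [Finite V] [DecidableEq V] {K : Type u} [Field K] {A : Type u} [CommRing A]
  [IsLocalRing A] {G : SimpleGraph V} {c : V → K} {ι : MvPolynomial V K →+* A}

/-- At a point where two components `M₁`, `M₂` meet in a linear space spanned by `M₁ ∩ M₂`,
the depth is at most `|M₁ ∩ M₂| + 1`. -/
theorem exists_nontrivial_extMod (hι : IsLocalizationAtPoint (edgeIdeal K G) c ι) {M₁ M₂ : Finset V}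
    (hM₁ : IsIndepSet G M₁) (hM₂ : IsIndepSet G M₂) (hc : ∀ v, c v ≠ 0 ↔ v ∈ M₁ ∩ M₂)
    (hout : ∀ u ∉ M₁, u ∉ M₂ → ∃ w ∈ M₁ ∩ M₂, G.Adj u w)
    (hcross : ∀ u ∈ M₁ \ M₂, ∀ v ∈ M₂ \ M₁, G.Adj u v) (hne₁ : (M₁ \ M₂).Nonempty)
    (hne₂ : (M₂ \ M₁).Nonempty) :
    ∃ m ≤ (M₁ ∩ M₂).card + 1, Nontrivial (ExtMod A m (IsLocalRing.ResidueField A) A) := by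
  by_contra! hE
  let P : ProjectiveResolution (ModuleCat.of A (IsLocalRing.ResidueField A)) :=
    projectiveResolution _
  have hc₁ : ∀ v ∉ M₁, c v = 0 := fun v hv => by
    by_contra h
    exact hv (Finset.mem_inter.1 ((hc v).1 h)).1
  have hc₂ : ∀ v ∉ M₂, c v = 0 := fun v hv => by
    by_contra h
    exact hv (Finset.mem_inter.1 ((hc v).1 h)).2
  have hle₁ : ∀ W ⊆ M₁, edgeIdeal K G ≤ linearIdeal c W := fun W hW =>
    (edgeIdeal_le_linearIdeal hM₁ hc₁).trans (linearIdeal_anti c hW)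
  have hle₂ : ∀ W ⊆ M₂, edgeIdeal K G ≤ linearIdeal c W := fun W hW =>
    (edgeIdeal_le_linearIdeal hM₂ hc₂).trans (linearIdeal_anti c hW)
  have hsat : ∀ W : Finset V, ∀ u f, eval c u ≠ 0 → u * f ∈ linearIdeal c W → f ∈ linearIdeal c W :=
    fun W u f => mem_linearIdeal_of_mul_mem c
  let Q : Finset V → Ideal (MvPolynomial V K) := fun T =>
    linearIdeal c (M₁ \ T) ⊓ linearIdeal c (M₂ \ T)
  have hleQ : ∀ T, edgeIdeal K G ≤ Q T := fun T =>
    le_inf (hle₁ _ Finset.sdiff_subset) (hle₂ _ Finset.sdiff_subset)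
  have hsatQ : ∀ T, ∀ u f, eval c u ≠ 0 → u * f ∈ Q T → f ∈ Q T := fun T u f hu h =>
    ⟨hsat _ u f hu h.1, hsat _ u f hu h.2⟩
  have key : ∀ T ⊆ M₁ ∩ M₂, ∀ n, T.card + n ≤ (M₁ ∩ M₂).card + 1 →
      HomCocyclesAreCoboundaries P.complex n (A ⧸ (Q T).map ι) := by
    intro T
    induction T using Finset.induction_on with
    | empty =>
      intro _ n hn
      have hbot : (Q ∅).map ι = ⊥ := by
        rw [eq_bot_iff, Ideal.map_le_iff_le_comap]
        intro f hf
        simp only [Q, Finset.sdiff_empty] at hf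
        refine (hι.eq_zero_iff f).2 ⟨∏ w ∈ M₁ ∩ M₂, X w, ?_,
          prod_X_mul_mem_edgeIdeal hc₁ hc₂ hout hcross hf⟩
        rw [map_prod, Finset.prod_ne_zero_iff]
        intro w hw
        rw [eval_X]
        exact (hc w).2 hw
      refine (homCocyclesAreCoboundaries_of_subsingleton_ext (M := A) P n ?_).of_equiv
        (Submodule.quotEquivOfEqBot _ hbot).symm
      exact not_nontrivial_iff_subsingleton.2 (hE n (by simpa using hn))
    | insert v T hv ih =>
      intro hT n hn
      have hT' : T ⊆ M₁ ∩ M₂ := (Finset.subset_insert v T).trans hT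
      have hvM := Finset.mem_inter.1 (hT (Finset.mem_insert_self v T))
      rw [Finset.card_insert_of_notMem hv] at hn
      refine (ih hT' (n + 1) (by omega)).quotient_sup_span_singleton (projective_X P n)
        (t := ι (X v - C (c v))) ?_ ?_ (ih hT' n (by omega))
      · rw [← Set.image_singleton (f := ι), ← Ideal.map_span, ← Ideal.map_sup]
        congr 1
        refine le_antisymm ?_ (sup_le ?_ ?_)
        · simp only [Q, Finset.sdiff_insert]
          exact linearIdeal_erase_inf_le c _ _ v
        · exact inf_le_inf (linearIdeal_anti c (Finset.sdiff_subset_sdiff subset_rfl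
            (Finset.subset_insert v T))) (linearIdeal_anti c (Finset.sdiff_subset_sdiff subset_rfl
            (Finset.subset_insert v T)))
        · rw [Ideal.span_singleton_le_iff_mem]
          exact ⟨(X_sub_C_mem_linearIdeal c).2 (by simp), (X_sub_C_mem_linearIdeal c).2 (by simp)⟩
      · intro a ha
        obtain ⟨s, u, hu, hs⟩ := hι.surj a
        rw [hι.mem_map_iff (hleQ T) (hsatQ T) hu hs]
        have hmem := (hι.mem_map_iff (s := (X v - C (c v)) * s) (hleQ T) (hsatQ T) hu (by
          rw [map_mul, ← hs, mul_assoc])).1 ha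
        refine ⟨(Ideal.IsPrime.mem_or_mem inferInstance hmem.1).resolve_left ?_,
          (Ideal.IsPrime.mem_or_mem inferInstance hmem.2).resolve_left ?_⟩
        · simp [X_sub_C_mem_linearIdeal, hvM, hv]
        · simp [X_sub_C_mem_linearIdeal, hvM, hv]
  have hfin := key (M₁ ∩ M₂) subset_rfl 1 le_rfl
  have hQ : (Q (M₁ ∩ M₂)).map ι =
      (linearIdeal c (M₁ \ M₂)).map ι ⊓ (linearIdeal c (M₂ \ M₁)).map ι := by
    ext a
    obtain ⟨s, u, hu, hs⟩ := hι.surj a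
    rw [Ideal.mem_inf, hι.mem_map_iff (hleQ _) (hsatQ _) hu hs,
      hι.mem_map_iff (hle₁ _ Finset.sdiff_subset) (hsat _) hu hs,
      hι.mem_map_iff (hle₂ _ Finset.sdiff_subset) (hsat _) hu hs]
    simp only [Q, Finset.sdiff_inter_self_left, Finset.sdiff_inter_self_right, Ideal.mem_inf]
  rw [hQ] at hfin
  have hmax : (linearIdeal c ∅).map ι = IsLocalRing.maximalIdeal A := by
    ext a
    obtain ⟨s, u, hu, hs⟩ := hι.surj a
    rw [hι.mem_map_iff (hle₁ _ (Finset.empty_subset _)) (hsat _) hu hs, mem_linearIdeal_empty,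
      ← Ideal.mul_unit_mem_iff_mem _ (hι.isUnit u hu), hs, IsLocalRing.mem_maximalIdeal,
      mem_nonunits_iff]
    refine ⟨fun h hunit => ?_, fun h => by_contra fun h' => h (hι.isUnit s h')⟩
    have := hι.isPrime_map (hle₁ _ (Finset.empty_subset _)) (hsat _)
    refine this.ne_top (Ideal.eq_top_of_isUnit_mem _ ?_ hunit)
    exact Ideal.mem_map_of_mem ι ((mem_linearIdeal_empty c).2 h)
  have hdepth : ∀ W : Finset V, W.Nonempty → edgeIdeal K G ≤ linearIdeal c W → ∀ a,
      (∀ b ∈ IsLocalRing.maximalIdeal A, b * a ∈ (linearIdeal c W).map ι) →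
      a ∈ (linearIdeal c W).map ι := by
    rintro W ⟨v, hv⟩ hW a ha
    have hprime := hι.isPrime_map hW (hsat W)
    refine (hprime.mem_or_mem (ha (ι (X v - C (c v))) ?_)).resolve_left fun h => ?_
    · rw [← hmax]
      exact Ideal.mem_map_of_mem ι ((X_sub_C_mem_linearIdeal c).2 (Finset.notMem_empty v))
    · exact (X_sub_C_mem_linearIdeal c).1 ((hι.apply_mem_map_iff hW (hsat W)).1 h) hv
  have : Nontrivial (A ⧸ IsLocalRing.maximalIdeal A) :=
    inferInstanceAs (Nontrivial (IsLocalRing.ResidueField A))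
  refine not_homCocyclesAreCoboundaries_one_quotient_inf (m := IsLocalRing.maximalIdeal A) P ?_
    (hdepth _ hne₁ (hle₁ _ Finset.sdiff_subset)) (hdepth _ hne₂ (hle₂ _ Finset.sdiff_subset)) hfin
  rw [← Ideal.map_sup, linearIdeal_sup, ← hmax]
  congr 2
  ext v
  simp
  tauto

end IsLocalizationAtPoint

theorem card_le_of_isCohenMacaulayRing {V : Type} [Finite V] [DecidableEq V] {K : Type u} [Field K]
    {G : SimpleGraph V} (hCM : IsCohenMacaulayRing (MvPolynomial V K ⧸ edgeIdeal K G))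
    {M₁ M₂ : Finset V} (hM₁ : IsIndepSet G M₁) (hM₂ : IsIndepSet G M₂)
    (hout : ∀ u ∉ M₁, u ∉ M₂ → ∃ w ∈ M₁ ∩ M₂, G.Adj u w)
    (hcross : ∀ u ∈ M₁ \ M₂, ∀ v ∈ M₂ \ M₁, G.Adj u v) (hne₁ : (M₁ \ M₂).Nonempty)
    (hne₂ : (M₂ \ M₁).Nonempty) : M₁.card ≤ (M₁ ∩ M₂).card + 1 := by
  let c : V → K := fun v => if v ∈ M₁ ∩ M₂ then 1 else 0
  have hc : ∀ v, c v ≠ 0 ↔ v ∈ M₁ ∩ M₂ := fun v => by simp [c]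
  have hle : edgeIdeal K G ≤ linearIdeal c M₁ := edgeIdeal_le_linearIdeal hM₁ fun v hv => by
    by_contra h
    exact hv (Finset.mem_inter.1 ((hc v).1 h)).1
  have hev : ∀ f ∈ edgeIdeal K G, eval c f = 0 := fun f hf =>
    (mem_linearIdeal_empty c).1 (linearIdeal_anti c (Finset.empty_subset _) (hle hf))
  let e : MvPolynomial V K ⧸ edgeIdeal K G →+* K := Ideal.Quotient.lift _ (eval c) hev
  have he : Function.Surjective e := fun r => ⟨Ideal.Quotient.mk _ (C r), by simp [e]⟩
  have hmax : (RingHom.ker e).IsMaximal := RingHom.ker_isMaximal_of_surjective e he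
  have hι := isLocalizationAtPoint_atPrime (edgeIdeal K G) c (RingHom.ker e) fun f => by
    simp [e, RingHom.mem_ker]
  have hdim := hι.card_le_ringKrullDim hle
  rw [← hCM (RingHom.ker e)] at hdim
  obtain ⟨m, hm, hE⟩ := hι.exists_nontrivial_extMod hM₁ hM₂ hc hout hcross hne₁ hne₂
  have hdepth : localRingDepth (Localization.AtPrime (RingHom.ker e)) ≤ m := sInf_le ⟨m, rfl, hE⟩
  have : (M₁.card : ℕ∞) ≤ m := le_trans (by exact_mod_cast hdim) hdepth
  exact le_trans (by exact_mod_cast this) hm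

end DepthAndDimension

section Combinatorics

theorem exists_isMinVertexCover_subset {V : Type*} [Finite V] {G : SimpleGraph V} {D : Set V}
    (hD : IsVertexCover G D) : ∃ C ⊆ D, IsMinVertexCover G C := by
  obtain ⟨C, hCD, hC⟩ := (Set.toFinite {C | IsVertexCover G C}).exists_le_minimal hD
  exact ⟨C, hCD, hC.prop, fun B hBC hB => Set.Subset.antisymm hBC (hC.le_of_le hB hBC)⟩

variable {h : ℕ} {G : SimpleGraph (Fin h ⊕ Fin h)}

theorem adj_of_adj_matched (hunm : IsUnmixedGraph G) (hstar : CondStar G) {k : Fin h}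
    {z w : Fin h ⊕ Fin h} (hz : G.Adj z (Sum.inl k)) (hw : G.Adj (Sum.inr k) w) : G.Adj z w := by
  by_contra hzw
  have hwz : ¬ G.Adj w z := fun h' => hzw h'.symm
  obtain ⟨C, hC, hCmin⟩ := exists_isMinVertexCover_subset (G := G) (D := {z, w}ᶜ) (by
    intro u v huv
    by_contra! hcon
    simp only [Set.mem_compl_iff, not_not, Set.mem_insert_iff, Set.mem_singleton_iff] at hcon
    obtain ⟨rfl | rfl, rfl | rfl⟩ := hcon
    · exact G.irrefl huv
    · exact hzw huv
    · exact hwz huv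
    · exact G.irrefl huv)
  have hzC : z ∉ C := fun h' => hC h' (by simp)
  have hwC : w ∉ C := fun h' => hC h' (by simp)
  have hxk : Sum.inl k ∈ C := (hCmin.1 hz).resolve_left hzC
  have hyk : Sum.inr k ∈ C := (hCmin.1 hw).resolve_right hwC
  have hcard := hunm C _ hCmin hstar.1
  have hpair : ∀ l : Fin h, ∃ v ∈ C, v = Sum.inl l ∨ v = Sum.inr l := fun l =>
    (hCmin.1 (hstar.2.2 l)).elim (fun h' => ⟨_, h', Or.inl rfl⟩) fun h' => ⟨_, h', Or.inr rfl⟩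
  choose g hgC hg using hpair
  have hinj : Function.Injective g := fun l l' hl => by
    have h₁ := hg l
    have h₂ := hg l'
    rw [hl] at h₁
    rcases h₁ with h₁ | h₁ <;> rcases h₂ with h₂ | h₂ <;> simp_all
  have hrange : Set.range g = C := by
    refine Set.eq_of_subset_of_ncard_le (Set.range_subset_iff.2 hgC) ?_ (Set.toFinite C)
    rw [hcard, ← Set.image_univ, ← Set.image_univ, Set.ncard_image_of_injective _ hinj,
      Set.ncard_image_of_injective _ Sum.inl_injective]
  rw [← hrange] at hxk hyk
  obtain ⟨l, hl⟩ := hxk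
  obtain ⟨l', hl'⟩ := hyk
  have hlk : k = l := by simpa [hl] using hg l
  have hlk' : k = l' := by simpa [hl'] using hg l'
  rw [← hlk] at hl
  rw [← hlk', hl] at hl'
  simp at hl'

theorem not_adj_inr_inr (hstar : CondStar G) (i j : Fin h) : ¬ G.Adj (Sum.inr i) (Sum.inr j) :=
  fun hij => hstar.2.1.1 ⟨i, rfl⟩ ⟨j, rfl⟩ hij.ne hij

/-- The relation `x_i y_j ∈ E(G)` is transitive in an unmixed graph. -/
theorem adj_trans (hunm : IsUnmixedGraph G) (hstar : CondStar G) {i j k : Fin h}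
    (hij : G.Adj (Sum.inl i) (Sum.inr j)) (hjk : G.Adj (Sum.inl j) (Sum.inr k)) :
    G.Adj (Sum.inl i) (Sum.inr k) :=
  (adj_of_adj_matched hunm hstar hjk.symm hij.symm).symm

theorem not_adj_inl_inl_of_common (hunm : IsUnmixedGraph G) (hstar : CondStar G) {i k l : Fin h}
    (hik : G.Adj (Sum.inl i) (Sum.inr k)) (hil : G.Adj (Sum.inl i) (Sum.inr l)) :
    ¬ G.Adj (Sum.inl k) (Sum.inl l) := fun hkl => by
  have h₁ : G.Adj (Sum.inl l) (Sum.inl i) := adj_of_adj_matched hunm hstar hkl.symm hik.symm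
  exact G.irrefl (adj_of_adj_matched hunm hstar h₁.symm hil.symm)

open Classical in
/-- The transversal of the pairs `{x_k, y_k}` choosing `x_k` exactly when `k ∈ U`. -/
noncomputable def transversal (U : Set (Fin h)) : Finset (Fin h ⊕ Fin h) :=
  Finset.univ.filter (Sum.elim (fun k => k ∈ U) (fun k => k ∉ U))

@[simp]
theorem inl_mem_transversal {U : Set (Fin h)} {k : Fin h} :
    Sum.inl k ∈ transversal U ↔ k ∈ U := by simp [transversal]

@[simp]
theorem inr_mem_transversal {U : Set (Fin h)} {k : Fin h} :
    Sum.inr k ∈ transversal U ↔ k ∉ U := by simp [transversal]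

theorem isIndepSet_transversal (hstar : CondStar G) {U : Set (Fin h)}
    (hup : ∀ k ∈ U, ∀ l, G.Adj (Sum.inl k) (Sum.inr l) → l ∈ U)
    (hind : ∀ k ∈ U, ∀ l ∈ U, ¬ G.Adj (Sum.inl k) (Sum.inl l)) :
    IsIndepSet G (transversal U) := by
  rintro (k | k) hu (l | l) hv - huv
  · exact hind k (by simpa using hu) l (by simpa using hv) huv
  · exact (inr_mem_transversal.1 (Finset.mem_coe.1 hv)) (hup k (by simpa using hu) l huv)
  · exact (inr_mem_transversal.1 (Finset.mem_coe.1 hu)) (hup l (by simpa using hv) k huv.symm)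
  · exact not_adj_inr_inr hstar k l huv

theorem eq_of_adj_of_adj {K : Type u} [Field K] (hunm : IsUnmixedGraph G) (hstar : CondStar G)
    (hCM : IsCohenMacaulayRing (MvPolynomial (Fin h ⊕ Fin h) K ⧸ edgeIdeal K G)) {i j : Fin h}
    (hij : G.Adj (Sum.inl i) (Sum.inr j)) (hji : G.Adj (Sum.inl j) (Sum.inr i)) : i = j := by
  by_contra hne
  let U₁ : Set (Fin h) := {k | G.Adj (Sum.inl i) (Sum.inr k)}
  let U₂ : Set (Fin h) := {k | G.Adj (Sum.inl i) (Sum.inr k) ∧ ¬ G.Adj (Sum.inl k) (Sum.inr i)}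
  have htrans : ∀ {a b d : Fin h}, G.Adj (Sum.inl a) (Sum.inr b) → G.Adj (Sum.inl b) (Sum.inr d) →
    G.Adj (Sum.inl a) (Sum.inr d) := adj_trans hunm hstar
  have hM₁ : IsIndepSet G (transversal U₁) := isIndepSet_transversal hstar
    (fun k hk l hl => htrans hk hl) fun k hk l hl => not_adj_inl_inl_of_common hunm hstar hk hl
  have hM₂ : IsIndepSet G (transversal U₂) := isIndepSet_transversal hstar
    (fun k hk l hl => ⟨htrans hk.1 hl, fun h' => hk.2 (htrans hl h')⟩)
    fun k hk l hl => not_adj_inl_inl_of_common hunm hstar hk.1 hl.1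
  have hii := hstar.2.2 i
  have hle := card_le_of_isCohenMacaulayRing hCM hM₁ hM₂ ?_ ?_
    ⟨Sum.inl i, by simp [U₁, U₂, hii]⟩ ⟨Sum.inr i, by simp [U₁, U₂, hii]⟩
  · have hsub : {Sum.inl i, Sum.inl j} ⊆ transversal U₁ \ transversal U₂ := by
      intro v hv
      simp only [Finset.mem_insert, Finset.mem_singleton] at hv
      rcases hv with rfl | rfl <;> simp [U₁, U₂, hii, hij, hji]
    have h2 := Finset.card_le_card hsub
    rw [Finset.card_pair (by simpa using hne)] at h2
    have := Finset.card_sdiff_add_card_inter (transversal U₁) (transversal U₂)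
    omega
  · rintro (k | k) h₁ h₂
    · refine ⟨Sum.inr k, ?_, hstar.2.2 k⟩
      simp only [inl_mem_transversal, inr_mem_transversal, Finset.mem_inter] at *
      exact ⟨h₁, h₂⟩
    · refine ⟨Sum.inl k, ?_, (hstar.2.2 k).symm⟩
      simp only [inl_mem_transversal, inr_mem_transversal, Finset.mem_inter, not_not] at *
      exact ⟨h₁, h₂⟩
  · rintro (k | k) hu (l | l) hv <;>
      simp only [Finset.mem_sdiff, inl_mem_transversal, inr_mem_transversal, not_not] at hu hv
    · exact absurd hv.1.1 hv.2
    · have hki : G.Adj (Sum.inl k) (Sum.inr i) := by_contra fun h' => hu.2 ⟨hu.1, h'⟩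
      exact htrans hki hv.2
    · exact absurd hv.1.1 hv.2
    · exact absurd hu.2.1 hu.1

/-- A finite partial order has a linear extension. -/
theorem exists_equiv_fin_of_partialOrder {α : Type*} [Fintype α] [PartialOrder α] {n : ℕ}
    (hn : Fintype.card α = n) : ∃ e : Fin n ≃ α, ∀ i j, e i ≤ e j → i ≤ j := by
  let _ : Fintype (LinearExtension α) := inferInstanceAs (Fintype α)
  let e : Fin n ≃o LinearExtension α := Fintype.orderIsoFinOfCardEq _ hn
  exact ⟨e.toEquiv, fun i j hij => e.le_iff_le.1 ((toLinearExtension (α := α)).monotone hij)⟩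

end Combinatorics

/-- If `G` is an unmixed graph with `2h` non-isolated vertices labeled so that condition
(*) holds, and `G` is Cohen-Macaulay, then there is a simultaneous relabeling of the `x_i`
and the `y_i` (by a permutation `σ`) after which `x_i y_j ∈ E(G)` implies `i ≤ j`. -/
theorem exists_relabeling_of_CM {h : ℕ} (K : Type u) [Field K]
    (G : SimpleGraph (Fin h ⊕ Fin h)) (hiso : HasNoIsolatedVertices G)
    (hunm : IsUnmixedGraph G) (hstar : CondStar G)
    (hCM : IsCohenMacaulayRing (MvPolynomial (Fin h ⊕ Fin h) K ⧸ edgeIdeal K G)) :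
    ∃ σ : Equiv.Perm (Fin h), ∀ i j : Fin h,
      G.Adj (Sum.inl (σ i)) (Sum.inr (σ j)) → i ≤ j := by
  let _ : PartialOrder (Fin h) :=
    { le := fun i j => G.Adj (Sum.inl i) (Sum.inr j)
      lt := fun i j => G.Adj (Sum.inl i) (Sum.inr j) ∧ ¬ G.Adj (Sum.inl j) (Sum.inr i)
      lt_iff_le_not_ge := fun _ _ => Iff.rfl
      le_refl := hstar.2.2
      le_trans := fun _ _ _ => adj_trans hunm hstar
      le_antisymm := fun _ _ => eq_of_adj_of_adj hunm hstar hCM }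
  exact exists_equiv_fin_of_partialOrder (Fintype.card_fin h)
end
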